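/- Let α be a cone angle on ℝ^d with d ≥ 1 and let P ⊂ ℝ^d be a full-dimensional polytope. Then Gram's relation holds: α̂_0(P) − α̂_1(P) + α̂_2(P) − ⋯ + (−1)^{d−1} α̂_{d−1}(P) = (−1)^{d+1}. -/

import Mathlib

open scoped BigOperators InnerProductSpace Pointwise

noncomputable section

/-- Euclidean space `ℝ^d`. -/
abbrev Euc (d : ℕ) : Type := EuclideanSpace ℝ (Fin d)

namespace GramAngles

variable {d : ℕ}

/-- The conical (positive) hull of a set. -/
def posHull (S : Set (Euc d)) : Set (Euc d) :=
  {u | ∃ c : ℝ, ∃ p ∈ S, 0 ≤ c ∧ u = c • p}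

/-- The dimension of a set: the rank of the linear subspace parallel to its affine hull. -/
def sdim (S : Set (Euc d)) : ℕ := Module.finrank ℝ (vectorSpan ℝ S)

/-- A polyhedral cone with apex at the origin: a finitely generated convex cone. -/
def IsPolyhedralCone (C : Set (Euc d)) : Prop :=
  ∃ (n : ℕ) (v : Fin n → Euc d),
    C = {x | ∃ c : Fin n → ℝ, (∀ i, 0 ≤ c i) ∧ x = ∑ i, c i • v i}

/-- A cone angle on `ℝ^d`: a simple, normalized valuation on polyhedral cones. -/
structure ConeAngle (d : ℕ) where
  toFun : Set (Euc d) → ℝ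
  zero' : toFun {0} = 0
  union' : ∀ C C' : Set (Euc d), IsPolyhedralCone C → IsPolyhedralCone C' →
    IsPolyhedralCone (C ∪ C') → IsPolyhedralCone (C ∩ C') →
    toFun (C ∪ C') = toFun C + toFun C' - toFun (C ∩ C')
  simple' : ∀ C : Set (Euc d), IsPolyhedralCone C → sdim C < d → toFun C = 0
  norm' : toFun Set.univ = 1

/-- A (convex) polytope: the convex hull of a nonempty finite point set. -/
def IsPolytope (P : Set (Euc d)) : Prop :=
  ∃ s : Finset (Euc d), s.Nonempty ∧ P = convexHull ℝ (s : Set (Euc d))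

/-- Faces of a polytope are its exposed subsets (including `∅` and `P` itself). -/
def IsFace (P F : Set (Euc d)) : Prop := IsExposed ℝ P F

open Classical in
/-- A chosen point in the relative interior of `F`. -/
def relPt (F : Set (Euc d)) : Euc d :=
  if h : (intrinsicInterior ℝ F).Nonempty then h.some else 0

/-- The tangent (inner) cone `T_F G = cone(-q + G) + L(G)^⊥`, `q ∈ relint F`. -/
def innerCone (F G : Set (Euc d)) : Set (Euc d) :=
  posHull ((fun x => x - relPt F) '' G) + (((vectorSpan ℝ G)ᗮ : Submodule ℝ (Euc d)) : Set (Euc d))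

/-- The normal cone `N_F G` of `G` at a face `F`. -/
def normalCone (F G : Set (Euc d)) : Set (Euc d) :=
  {c | ∀ x ∈ F, ∀ y ∈ G, ⟪c, y⟫_ℝ ≤ ⟪c, x⟫_ℝ}

/-- The outer cone `O_F G = N_F G + L(F)`. -/
def outerCone (F G : Set (Euc d)) : Set (Euc d) :=
  normalCone F G + ((vectorSpan ℝ F : Submodule ℝ (Euc d)) : Set (Euc d))

/-- Interior angle of `G` at its face `F`, measured by the cone angle `α`. -/
def intAngle (α : ConeAngle d) (F G : Set (Euc d)) : ℝ := α.toFun (innerCone F G)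

/-- Exterior angle of `G` at its face `F`, measured by the cone angle `α`. -/
def extAngle (α : ConeAngle d) (F G : Set (Euc d)) : ℝ := α.toFun (outerCone F G)

/-- `α̂_i(P)`: sum of interior angles over all `i`-dimensional (nonempty) faces of `P`. -/
def intAngleSum (α : ConeAngle d) (P : Set (Euc d)) (i : ℕ) : ℝ :=
  ∑ᶠ F ∈ {F : Set (Euc d) | IsFace P F ∧ F.Nonempty ∧ sdim F = i}, intAngle α F P

/-- `α̌_i(P)`: sum of exterior angles over all `i`-dimensional (nonempty) faces of `P`. -/
def extAngleSum (α : ConeAngle d) (P : Set (Euc d)) (i : ℕ) : ℝ :=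
  ∑ᶠ F ∈ {F : Set (Euc d) | IsFace P F ∧ F.Nonempty ∧ sdim F = i}, extAngle α F P

/-- A zonotope: a translate of a Minkowski sum of finitely many segments. -/
def IsZonotope (Z : Set (Euc d)) : Prop :=
  ∃ (t : Euc d) (n : ℕ) (z : Fin n → Euc d),
    Z = {x | ∃ l : Fin n → ℝ, (∀ i, |l i| ≤ 1) ∧ x = t + ∑ i, l i • z i}

/-- The face of `P` on which the linear functional `⟪c, ·⟫` is maximized. -/
def maxFace (P : Set (Euc d)) (c : Euc d) : Set (Euc d) :=
  {x ∈ P | ∀ y ∈ P, ⟪c, y⟫_ℝ ≤ ⟪c, x⟫_ℝ}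

/-- A belt polytope: a polytope whose normal fan is the fan induced by a central
hyperplane arrangement (two functionals maximize the same face iff they have the
same sign pattern with respect to the arrangement). -/
def IsBeltPolytope (P : Set (Euc d)) : Prop :=
  IsPolytope P ∧ ∃ (k : ℕ) (z : Fin k → Euc d), (∀ i, z i ≠ 0) ∧
    ∀ c c' : Euc d,
      ((∀ i, Real.sign ⟪z i, c⟫_ℝ = Real.sign ⟪z i, c'⟫_ℝ) ↔ maxFace P c = maxFace P c')

/-- The set of flats of a polytope: linear subspaces parallel to nonempty faces,
ordered by inclusion (as a subtype of `Submodule ℝ (Euc d)`). -/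
def Flats (P : Set (Euc d)) : Set (Submodule ℝ (Euc d)) :=
  {L | ∃ F : Set (Euc d), IsFace P F ∧ F.Nonempty ∧ L = vectorSpan ℝ F}

/-- Strictly increasing chains from `a` to `c` in a poset, encoded as lists. -/
def chainsFromTo {β : Type*} [Preorder β] (a c : β) : Set (List β) :=
  {l | l.Chain' (· < ·) ∧ l.head? = some a ∧ l.getLast? = some c}

/-- The Möbius function of a poset, via Philip Hall's chain formula. -/
def mob {β : Type*} [Preorder β] (a c : β) : ℝ :=
  ∑ᶠ l ∈ chainsFromTo a c, (-1 : ℝ) ^ (l.length + 1)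

/-- Whitney numbers of the first kind of a ranked poset with minimum `bot`. -/
def whitney1 {β : Type*} [Preorder β] (rk : β → ℕ) (bot : β) (i : ℕ) : ℝ :=
  ∑ᶠ a ∈ {a : β | rk a = i}, mob bot a

/-- Flag-Whitney numbers of the second kind: the number of chains with rank set `S`. -/
def flagW2 {β : Type*} [Preorder β] (rk : β → ℕ) (S : Finset ℕ) : ℕ :=
  Nat.card {l : List β // l.Chain' (· < ·) ∧ l.map rk = S.sort (· ≤ ·)}

/-- Flag-Whitney numbers of the first kind:
`w_S = Σ μ(0̂,c₁) μ(c₁,c₂) ⋯ μ(c_{k-1},c_k)` over chains with rank set `S`. -/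
def flagW1 {β : Type*} [Preorder β] (rk : β → ℕ) (bot : β) (S : Finset ℕ) : ℝ :=
  ∑ᶠ l ∈ {l : List β | l.Chain' (· < ·) ∧ l.map rk = S.sort (· ≤ ·)},
    (List.zipWith mob (bot :: l) l).prod

/-- Chains of nonempty faces of `P` whose dimensions are exactly the set `S`. -/
def faceChains (P : Set (Euc d)) (S : Finset ℕ) : Set (List (Set (Euc d))) :=
  {l | (∀ F ∈ l, IsFace P F ∧ F.Nonempty) ∧ l.Chain' (· ⊂ ·) ∧ l.map sdim = S.sort (· ≤ ·)}

/-- The interior flag-angle `α̂_S(P) = Σ α̂(F₁,F₂) α̂(F₂,F₃) ⋯ α̂(F_k,P)`. -/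
def intFlag (α : ConeAngle d) (P : Set (Euc d)) (S : Finset ℕ) : ℝ :=
  ∑ᶠ l ∈ faceChains P S, (List.zipWith (intAngle α) l (l.drop 1 ++ [P])).prod

/-- The exterior flag-angle `α̌_S(P) = Σ α̌(F₁,F₂) α̌(F₂,F₃) ⋯ α̌(F_k,P)`. -/
def extFlag (α : ConeAngle d) (P : Set (Euc d)) (S : Finset ℕ) : ℝ :=
  ∑ᶠ l ∈ faceChains P S, (List.zipWith (extAngle α) l (l.drop 1 ++ [P])).prod

/-- Membership in the incidence algebra: vanishing off the order relation. -/
def memIA {β : Type*} [Preorder β] (h : β → β → ℝ) : Prop :=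
  ∀ a c, ¬ a ≤ c → h a c = 0

/-- Convolution product of the incidence algebra. -/
def conv {β : Type*} [Preorder β] (g h : β → β → ℝ) (a c : β) : ℝ :=
  ∑ᶠ (b : β) (_ : a ≤ b ∧ b ≤ c), g a b * h b c

/-- The product `∗_k`, summing over middle elements of rank `k`. -/
def convk {β : Type*} (rk : β → ℕ) (k : ℕ) (g h : β → β → ℝ) (a c : β) : ℝ :=
  ∑ᶠ (b : β) (_ : rk b = k), g a b * h b c

/-- The pushforward `φ_* h (q,q') = |φ⁻¹(q')|⁻¹ Σ_{p ∈ φ⁻¹(q), p' ∈ φ⁻¹(q')} h(p,p')`. -/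
def pushf {β γ : Type*} (φ : β → γ) (h : β → β → ℝ) (q q' : γ) : ℝ :=
  (Nat.card {p : β // φ p = q'} : ℝ)⁻¹ *
    ∑ᶠ (p : β) (_ : φ p = q) (p' : β) (_ : φ p' = q'), h p p'

/-- The subspace `I_φ(𝒫)`: elements whose fiberwise column sums are independent of
the representative of the target fiber. -/
def memIphi {β γ : Type*} [Preorder β] (φ : β → γ) (h : β → β → ℝ) : Prop :=
  memIA h ∧ ∀ (q : γ) (p₁ p₂ : β), φ p₁ = φ p₂ →
    (∑ᶠ (p : β) (_ : φ p = q), h p p₁) = (∑ᶠ (p : β) (_ : φ p = q), h p p₂)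

open Classical in
/-- The pullback `φ^* g (p,p') = g(φ p, φ p')` for `p ≤ p'`, else `0`. -/
def pullb {β γ : Type*} [Preorder β] (φ : β → γ) (g : γ → γ → ℝ) (p p' : β) : ℝ :=
  if p ≤ p' then g (φ p) (φ p') else 0

open Classical in
/-- The identity `δ` of the incidence algebra. -/
def deltaIA {β : Type*} (a c : β) : ℝ := if a = c then 1 else 0

end GramAngles

namespace GramAngles

section ConeFG
variable {V : Type*} [AddCommGroup V] [Module ℝ V]

lemma hull_smul_mem (K : PointedCone ℝ V) {c : ℝ} (hc : 0 ≤ c) {x : V} (hx : x ∈ K) : c • x ∈ K :=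
  K.smul_mem hc hx

lemma fg_inter_half (s : Finset V) (f : Module.Dual ℝ V) :
    ∃ t : Finset V, ∀ x, (x ∈ PointedCone.hull ℝ (s : Set V) ∧ f x ≤ 0) ↔
      x ∈ PointedCone.hull ℝ (t : Set V) := by
  classical
  set sp := s.filter (fun v => 0 < f v) with hsp
  set sm := s.filter (fun v => f v ≤ 0) with hsm
  set t : Finset V := sm ∪ (sp ×ˢ sm).image (fun q => f q.1 • q.2 - f q.2 • q.1) with ht
  set K := PointedCone.hull ℝ (t : Set V) with hK
  have hmK : ∀ m ∈ PointedCone.hull ℝ (sm : Set V), m ∈ K := by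
    intro m hm
    exact Submodule.span_mono (by rw [ht]; push_cast; exact Set.subset_union_left) hm
  have hm0 : ∀ m ∈ PointedCone.hull ℝ (sm : Set V), f m ≤ 0 := by
    intro m hm
    induction hm using Submodule.span_induction with
    | mem x hx => simp [hsm] at hx; exact hx.2
    | zero => simp
    | add x y _ _ hx hy => rw [map_add]; linarith
    | smul c x _ hx =>
      have : f (c • x) = (c : ℝ) * f x := by
        change f ((c : ℝ) • x) = _
        rw [map_smul, smul_eq_mul]
      rw [this]; exact mul_nonpos_of_nonneg_of_nonpos c.2 hx
  have hp0 : ∀ p ∈ PointedCone.hull ℝ (sp : Set V), p = 0 ∨ 0 < f p := by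
    intro m hm
    induction hm using Submodule.span_induction with
    | mem x hx => simp [hsp] at hx; exact Or.inr hx.2
    | zero => simp
    | add x y _ _ hx hy =>
      rcases hx with rfl | hx
      · simpa using hy
      · rcases hy with rfl | hy
        · simp [hx]
        · right; rw [map_add]; linarith
    | smul c x _ hx =>
      have : f (c • x) = (c : ℝ) * f x := by
        change f ((c : ℝ) • x) = _
        rw [map_smul, smul_eq_mul]
      rcases hx with rfl | hx
      · simp
      · rcases c.2.eq_or_lt with h | h
        · left
          change (c : ℝ) • x = 0
          rw [← h]; simp
        · right; rw [this]; exact mul_pos h hx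
  have hB : ∀ p ∈ PointedCone.hull ℝ (sp : Set V), ∀ m ∈ PointedCone.hull ℝ (sm : Set V),
      f p • m - f m • p ∈ K := by
    intro p hp m hm
    induction hp using Submodule.span_induction with
    | zero => simp
    | add x y _ _ hx hy =>
      have : f (x + y) • m - f m • (x + y) = (f x • m - f m • x) + (f y • m - f m • y) := by
        rw [map_add]; module
      rw [this]; exact K.add_mem hx hy
    | smul c x _ hx =>
      have : f (c • x) • m - f m • (c • x) = (c : ℝ) • (f x • m - f m • x) := by
        change f ((c : ℝ) • x) • m - f m • ((c : ℝ) • x) = _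
        rw [map_smul, smul_eq_mul]; module
      rw [this]; exact hull_smul_mem K c.2 hx
    | mem p hp =>
      induction hm using Submodule.span_induction with
      | zero => simp
      | add x y _ _ hx hy =>
        have : f p • (x + y) - f (x + y) • p = (f p • x - f x • p) + (f p • y - f y • p) := by
          rw [map_add]; module
        rw [this]; exact K.add_mem hx hy
      | smul c x _ hx =>
        have : f p • (c • x) - f (c • x) • p = (c : ℝ) • (f p • x - f x • p) := by
          change f p • ((c : ℝ) • x) - f ((c : ℝ) • x) • p = _
          rw [map_smul, smul_eq_mul]; module
        rw [this]; exact hull_smul_mem K c.2 hx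
      | mem m hm =>
        apply Submodule.subset_span
        rw [ht]
        push_cast
        right
        exact ⟨(p, m), by simpa using ⟨hp, hm⟩, rfl⟩
  refine ⟨t, fun x => ⟨?_, ?_⟩⟩
  · rintro ⟨hx, hfx⟩
    have hss : (s : Set V) = (sp : Set V) ∪ (sm : Set V) := by
      ext v
      simp only [hsp, hsm, Finset.coe_filter, Set.mem_union, Set.mem_ofPred_eq, Finset.mem_coe]
      rcases lt_or_ge 0 (f v) with h | h
      · simp [h]
      · simp [h, not_lt.2 h]
    rw [hss] at hx
    change x ∈ Submodule.span _ _ at hx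
    rw [Submodule.span_union, Submodule.mem_sup] at hx
    obtain ⟨p, hp, m, hm, rfl⟩ := hx
    rcases hp0 p hp with rfl | hfp
    · simpa using hmK m hm
    · rw [map_add] at hfx
      have hN : 0 < - f m := by linarith
      have : p + m = (- f m)⁻¹ • (f p • m - f m • p) + (1 - f p * (- f m)⁻¹) • m := by
        have h1 : (- f m)⁻¹ * (- f m) = 1 := inv_mul_cancel₀ hN.ne'
        calc p + m = ((- f m)⁻¹ * (- f m)) • p + m := by rw [h1, one_smul]
          _ = _ := by module
      rw [this]
      refine K.add_mem (hull_smul_mem K (by positivity) (hB p hp m hm))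
        (hull_smul_mem K ?_ (hmK m hm))
      rw [sub_nonneg, ← div_eq_mul_inv, div_le_one hN]
      linarith
  · intro hx
    have key : ∀ v ∈ t, v ∈ PointedCone.hull ℝ (s : Set V) ∧ f v ≤ 0 := by
      intro v hv
      rw [ht, Finset.mem_union, Finset.mem_image] at hv
      rcases hv with hv | ⟨⟨p, m⟩, hpm, rfl⟩
      · simp only [hsm, Finset.mem_filter] at hv
        exact ⟨Submodule.subset_span hv.1, hv.2⟩
      · simp only [hsm, hsp, Finset.mem_product, Finset.mem_filter] at hpm
        obtain ⟨⟨hp, hp'⟩, hm, hm'⟩ := hpm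
        constructor
        · have : f p • m - f m • p = f p • m + (- f m) • p := by module
          simp only [this]
          exact Submodule.add_mem _ (hull_smul_mem _ hp'.le (Submodule.subset_span hm))
            (hull_smul_mem _ (by linarith) (Submodule.subset_span hp))
        · simp only [map_sub, map_smul, smul_eq_mul]
          linarith
    induction hx using Submodule.span_induction with
    | mem x hx => exact key x hx
    | zero => simp
    | add x y _ _ hx hy => exact ⟨Submodule.add_mem _ hx.1 hy.1, by rw [map_add]; linarith [hx.2, hy.2]⟩
    | smul c x _ hx =>
      refine ⟨Submodule.smul_mem _ _ hx.1, ?_⟩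
      have : f (c • x) = (c : ℝ) * f x := by
        change f ((c : ℝ) • x) = _
        rw [map_smul, smul_eq_mul]
      rw [this]; exact mul_nonpos_of_nonneg_of_nonpos c.2 hx.2

lemma hcone_fg [FiniteDimensional ℝ V] {ι : Type*} (T : Finset ι) (f : ι → Module.Dual ℝ V) :
    ∃ s : Finset V, ∀ x, (∀ i ∈ T, f i x ≤ 0) ↔ x ∈ PointedCone.hull ℝ (s : Set V) := by
  classical
  induction T using Finset.induction_on with
  | empty =>
    let b := Module.finBasis ℝ V
    refine ⟨Finset.univ.image b ∪ Finset.univ.image (fun i => - b i), fun x => ?_⟩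
    simp only [Finset.notMem_empty, IsEmpty.forall_iff, implies_true, true_iff]
    rw [← b.sum_repr x]
    refine Submodule.sum_mem _ fun i _ => ?_
    rcases le_total 0 (b.repr x i) with h | h
    · exact hull_smul_mem _ h (Submodule.subset_span (by simp))
    · have : b.repr x i • b i = (- b.repr x i) • (- b i) := by module
      rw [this]
      exact hull_smul_mem _ (by linarith) (Submodule.subset_span (by simp))
  | insert i T hi ih =>
    obtain ⟨s, hs⟩ := ih
    obtain ⟨t, ht⟩ := fg_inter_half s (f i)
    refine ⟨t, fun x => ?_⟩
    rw [← ht, ← hs]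
    simp [and_comm]

end ConeFG

lemma isPolyhedralCone_hull {d : ℕ} (s : Finset (Euc d)) :
    IsPolyhedralCone (PointedCone.hull ℝ (s : Set (Euc d)) : Set (Euc d)) := by
  classical
  let e := s.equivFin
  refine ⟨s.card, fun i => (e.symm i : Euc d), ?_⟩
  ext x
  constructor
  · intro hx
    change x ∈ Submodule.span _ _ at hx
    rw [Submodule.mem_span_finset] at hx
    obtain ⟨c, -, hc⟩ := hx
    refine ⟨fun i => (c (e.symm i) : ℝ), fun i => (c _).2, ?_⟩
    rw [← hc, ← Finset.sum_coe_sort, ← e.symm.sum_comp]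
    rfl
  · rintro ⟨c, hc, rfl⟩
    exact Submodule.sum_mem _ fun i _ => hull_smul_mem _ (hc i) (Submodule.subset_span (e.symm i).2)

lemma isPolyhedralCone_hcone {d : ℕ} {ι : Type*} (T : Finset ι) (f : ι → Module.Dual ℝ (Euc d)) :
    IsPolyhedralCone {x | ∀ i ∈ T, f i x ≤ 0} := by
  obtain ⟨s, hs⟩ := hcone_fg T f
  have : {x | ∀ i ∈ T, f i x ≤ 0} = (PointedCone.hull ℝ (s : Set (Euc d)) : Set (Euc d)) := by
    ext x; exact hs x
  rw [this]
  exact isPolyhedralCone_hull s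

lemma polytope_hrep {d : ℕ} {P : Set (Euc d)} (hP : IsPolytope P) :
    ∃ (n : ℕ) (a : Fin n → Module.Dual ℝ (Euc d)) (b : Fin n → ℝ), (∀ i, a i ≠ 0) ∧
      P = {x | ∀ i, a i x ≤ b i} := by
  classical
  obtain ⟨s, hs, rfl⟩ := hP
  let g : Euc d → Module.Dual ℝ (Module.Dual ℝ (Euc d) × ℝ) := fun x =>
    (Module.Dual.eval ℝ (Euc d) x).comp (LinearMap.fst ℝ _ _) - LinearMap.snd ℝ _ _
  have hg : ∀ x y, g x y = y.1 x - y.2 := fun x y => rfl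
  obtain ⟨t, ht⟩ := hcone_fg s g
  simp only [hg, sub_nonpos] at ht
  set t' := t.filter (fun y => y.1 ≠ 0) with ht'
  let e := t'.equivFin
  refine ⟨t'.card, fun i => (e.symm i).1.1, fun i => (e.symm i).1.2, fun i => ?_, ?_⟩
  · exact (Finset.mem_filter.1 (e.symm i).2).2
  have hall : ∀ x : Euc d, (∀ i, (e.symm i).1.1 x ≤ (e.symm i).1.2) ↔ ∀ y ∈ t, y.1 x ≤ y.2 := by
    intro x
    constructor
    · intro h y hy
      by_cases hy0 : y.1 = 0
      · obtain ⟨v, hv⟩ := hs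
        have := (ht y).2 (Submodule.subset_span hy) v hv
        rw [hy0] at this ⊢
        simpa using this
      · have := h (e ⟨y, Finset.mem_filter.2 ⟨hy, hy0⟩⟩)
        simpa using this
    · intro h i
      exact h _ (Finset.mem_filter.1 (e.symm i).2).1
  ext x
  simp only [Set.mem_ofPred_eq]
  rw [hall]
  constructor
  · intro hx y hy
    have h1 := (ht y).2 (Submodule.subset_span hy)
    have : convexHull ℝ (s : Set (Euc d)) ⊆ {x | y.1 x ≤ y.2} :=
      convexHull_min h1 (convex_halfSpace_le y.1.isLinear _)
    exact this hx
  · intro hx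
    by_contra hxP
    obtain ⟨f, u, hu, hxu⟩ := geometric_hahn_banach_closed_point (convex_convexHull ℝ (s : Set (Euc d)))
      (s.finite_toSet.isCompact_convexHull ℝ).isClosed hxP
    have hD : ((f : Euc d →ₗ[ℝ] ℝ), u) ∈ PointedCone.hull ℝ (t : Set (Module.Dual ℝ (Euc d) × ℝ)) :=
      (ht _).1 fun v hv => (hu v (subset_convexHull ℝ _ hv)).le
    have : ∀ y ∈ PointedCone.hull ℝ (t : Set (Module.Dual ℝ (Euc d) × ℝ)), y.1 x ≤ y.2 := by
      intro y hy
      induction hy using Submodule.span_induction with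
      | mem y hy => exact hx y hy
      | zero => simp
      | add y z _ _ hy hz => simpa using add_le_add hy hz
      | smul c y _ hy =>
        change (c : ℝ) • (y.1 x) ≤ (c : ℝ) • y.2
        exact mul_le_mul_of_nonneg_left hy c.2
    have := this _ hD
    simp at this
    linarith

end GramAngles

namespace GramAngles

section Euler
open Classical Filter Topology

variable {E : Type*} [AddCommGroup E] [Module ℝ E]

/-- Nonempty, bounded, convex, relatively open sets (all notions algebraic). -/
structure ROC (A : Set E) : Prop where
  ne : A.Nonempty
  conv : Convex ℝ A
  ro : ∀ x ∈ A, ∀ v ∈ vectorSpan ℝ A, ∃ ε : ℝ, 0 < ε ∧ x + ε • v ∈ A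
  bd : ∀ l : Module.Dual ℝ E, ∃ M : ℝ, ∀ x ∈ A, l x ≤ M

lemma vectorSpan_image_linear {E' : Type*} [AddCommGroup E'] [Module ℝ E'] (A : Set E)
    (f : E →ₗ[ℝ] E') : vectorSpan ℝ (f '' A) = (vectorSpan ℝ A).map f := by
  have := AffineMap.map_vectorSpan (k := ℝ) (f.toAffineMap) (s := A)
  simpa using this.symm

lemma ROC.image {E' : Type*} [AddCommGroup E'] [Module ℝ E'] {A : Set E} (hA : ROC A)
    (f : E →ₗ[ℝ] E') : ROC (f '' A) where
  ne := hA.ne.image f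
  conv := hA.conv.linear_image f
  ro := by
    rintro _ ⟨x, hx, rfl⟩ v hv
    rw [vectorSpan_image_linear] at hv
    obtain ⟨w, hw, rfl⟩ := hv
    obtain ⟨ε, he, h⟩ := hA.ro x hx w hw
    exact ⟨ε, he, ⟨_, h, by simp⟩⟩
  bd := by
    intro l
    obtain ⟨M, hM⟩ := hA.bd (l.comp f)
    refine ⟨M, ?_⟩
    rintro _ ⟨x, hx, rfl⟩
    exact hM x hx

/-- Indicator with real values. -/
def ind {X : Type*} (A : Set X) (x : X) : ℝ := if x ∈ A then 1 else 0

/-- The sign of a fibre in direction `u`. -/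
def sgnF (A : Set E) (u : E) : ℝ := if u ∈ vectorSpan ℝ A then -1 else 1

lemma fiber_jump {A : Set E} (hA : ROC A) {u : E} (hu : u ≠ 0) (x0 : E)
    (h : ∃ t : ℝ, x0 + t • u ∈ A) :
    ∃ p : ℝ, ∀ x : ℝ, ∀ᶠ x' in 𝓝[>] x, ind A (x0 + x • u) - ind A (x0 + x' • u) =
      if x = p then sgnF A u else 0 := by
  by_cases huA : u ∈ vectorSpan ℝ A
  · simp only [sgnF, huA, if_true]
    set I : Set ℝ := {t | x0 + t • u ∈ A} with hI
    have hIne : I.Nonempty := h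
    obtain ⟨l, hl⟩ : ∃ l : Module.Dual ℝ E, l u = 1 := by
      exact Module.Projective.exists_dual_eq_one ℝ hu
    have hba : BddAbove I := by
      obtain ⟨M, hM⟩ := hA.bd l
      refine ⟨M - l x0, fun t ht => ?_⟩
      have := hM _ ht
      simp [hl] at this
      linarith
    have hbb : BddBelow I := by
      obtain ⟨M, hM⟩ := hA.bd (-l)
      refine ⟨- M - l x0, fun t ht => ?_⟩
      have := hM _ ht
      simp [hl] at this
      linarith
    have hup : ∀ t ∈ I, ∃ s ∈ I, t < s := by
      intro t ht
      obtain ⟨ε, he, h⟩ := hA.ro _ ht u huA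
      refine ⟨t + ε, ?_, by linarith⟩
      change x0 + (t + ε) • u ∈ A
      rwa [add_smul, ← add_assoc]
    have hdn : ∀ t ∈ I, ∃ s ∈ I, s < t := by
      intro t ht
      obtain ⟨ε, he, h⟩ := hA.ro _ ht (-u) (neg_mem huA)
      refine ⟨t - ε, ?_, by linarith⟩
      change x0 + (t - ε) • u ∈ A
      convert h using 1
      module
    have hIio : ∀ t, t ∈ I ↔ sInf I < t ∧ t < sSup I := by
      intro t
      constructor
      · intro ht
        obtain ⟨s, hs, hst⟩ := hdn t ht
        obtain ⟨s', hs', hst'⟩ := hup t ht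
        exact ⟨(csInf_le hbb hs).trans_lt hst, hst'.trans_le (le_csSup hba hs')⟩
      · rintro ⟨h1, h2⟩
        obtain ⟨s, hs, hst⟩ := exists_lt_of_csInf_lt hIne h1
        obtain ⟨s', hs', hst'⟩ := exists_lt_of_lt_csSup hIne h2
        have h3 := hA.conv hs hs' (a := (s' - t) / (s' - s)) (b := (t - s) / (s' - s))
          (div_nonneg (by linarith) (by linarith)) (div_nonneg (by linarith) (by linarith))
          (by rw [← add_div]; rw [div_eq_one_iff_eq] <;> linarith)
        change x0 + t • u ∈ A
        convert h3 using 1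
        have h4 : s' - s ≠ 0 := by linarith
        have e1 : (s' - t) / (s' - s) + (t - s) / (s' - s) = 1 := by field_simp; ring
        have e2 : (s' - t) / (s' - s) * s + (t - s) / (s' - s) * s' = t := by field_simp; ring
        calc x0 + t • u = ((s' - t) / (s' - s) + (t - s) / (s' - s)) • x0 +
              ((s' - t) / (s' - s) * s + (t - s) / (s' - s) * s') • u := by rw [e1, e2, one_smul]
          _ = _ := by module
    have hlt : sInf I < sSup I := by
      obtain ⟨t, ht⟩ := hIne
      have := (hIio t).1 ht
      linarith
    have hind : ∀ t, ind A (x0 + t • u) = if sInf I < t ∧ t < sSup I then 1 else 0 := by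
      intro t
      unfold ind
      exact if_congr (hIio t) rfl rfl
    refine ⟨sInf I, fun x => ?_⟩
    simp only [hind]
    generalize sInf I = p at *
    generalize sSup I = q at *
    have hgt : ∀ᶠ x' in 𝓝[>] x, x < x' := eventually_mem_nhdsWithin
    rcases lt_or_ge x p with h1 | h1
    · filter_upwards [(gt_mem_nhds h1).filter_mono nhdsWithin_le_nhds] with x' hx'
      simp [not_lt.2 h1.le, not_lt.2 hx'.le, h1.ne]
    rcases lt_or_ge x q with h2 | h2
    · filter_upwards [(gt_mem_nhds h2).filter_mono nhdsWithin_le_nhds, hgt] with x' hx' hx''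
      have h3 : p < x' := by linarith
      rcases h1.eq_or_lt with h4 | h4
      · simp [h4, hx', hx'']
      · simp [h4, h3, hx', h4.ne', h2]
    · filter_upwards [hgt] with x' hx'
      have h3 : ¬ x' < q := by linarith
      have h4 : x ≠ p := by intro h; linarith
      simp [h3, h4, not_lt.2 h2]
  · simp only [sgnF, huA, if_false]
    obtain ⟨p, hp⟩ := h
    have hI : ∀ t : ℝ, x0 + t • u ∈ A ↔ t = p := by
      intro t
      constructor
      · intro ht
        by_contra hne
        have h1 := vsub_mem_vectorSpan ℝ ht hp
        have h2 : (t - p) • u ∈ vectorSpan ℝ A := by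
          convert h1 using 1
          simp only [vsub_eq_sub]
          module
        exact huA ((Submodule.smul_mem_iff _ (sub_ne_zero.2 hne)).1 h2)
      · rintro rfl; exact hp
    refine ⟨p, fun x => ?_⟩
    simp only [ind, hI]
    have hgt : ∀ᶠ x' in 𝓝[>] x, x < x' := eventually_mem_nhdsWithin
    rcases lt_or_ge x p with h1 | h1
    · filter_upwards [(gt_mem_nhds h1).filter_mono nhdsWithin_le_nhds] with x' hx'
      simp [hx'.ne, h1.ne]
    · filter_upwards [hgt] with x' hx'
      have : x' ≠ p := by intro h; linarith
      simp [this]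

lemma euler_step {ι : Type*} (s : Finset ι) (A : ι → Set E) (hA : ∀ i ∈ s, ROC (A i)) (c : ι → ℝ)
    {u : E} (hu : u ≠ 0)
    (h : ∀ x0 : E, ∀ x : ℝ, ∀ᶠ x' in 𝓝[>] x,
      ∑ i ∈ s, c i * ind (A i) (x0 + x' • u) = ∑ i ∈ s, c i * ind (A i) (x0 + x • u))
    (y : E ⧸ Submodule.span ℝ {u}) :
    ∑ i ∈ s, (c i * sgnF (A i) u) * ind ((Submodule.span ℝ {u}).mkQ '' (A i)) y = 0 := by
  obtain ⟨x0, rfl⟩ := Submodule.mkQ_surjective _ y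
  have hmem : ∀ i, (Submodule.span ℝ {u}).mkQ x0 ∈ (Submodule.span ℝ {u}).mkQ '' (A i) ↔
      ∃ t : ℝ, x0 + t • u ∈ A i := by
    intro i
    constructor
    · rintro ⟨a, ha, hax⟩
      have : a - x0 ∈ Submodule.span ℝ {u} := by
        rw [← Submodule.ker_mkQ (Submodule.span ℝ {u}), LinearMap.mem_ker, map_sub, hax, sub_self]
      obtain ⟨t, ht⟩ := Submodule.mem_span_singleton.1 this
      exact ⟨t, by rw [ht]; simpa using ha⟩
    · rintro ⟨t, ht⟩
      refine ⟨_, ht, ?_⟩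
      have : (Submodule.span ℝ {u}).mkQ u = 0 := by
        rw [← LinearMap.mem_ker, Submodule.ker_mkQ]; exact Submodule.mem_span_singleton_self u
      rw [map_add, map_smul, this, smul_zero, add_zero]
  have hp : ∀ i, ∃ p : ℝ, i ∈ s → ∀ x : ℝ, ∀ᶠ x' in 𝓝[>] x,
      ind (A i) (x0 + x • u) - ind (A i) (x0 + x' • u) =
      if x = p then sgnF (A i) u * ind ((Submodule.span ℝ {u}).mkQ '' (A i))
        ((Submodule.span ℝ {u}).mkQ x0) else 0 := by
    intro i
    by_cases hi : i ∈ s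
    · by_cases ht : ∃ t : ℝ, x0 + t • u ∈ A i
      · obtain ⟨p, hp⟩ := fiber_jump (hA i hi) hu x0 ht
        refine ⟨p, fun _ x => ?_⟩
        have : ind ((Submodule.span ℝ {u}).mkQ '' (A i)) ((Submodule.span ℝ {u}).mkQ x0) = 1 := by
          unfold ind; rw [if_pos ((hmem i).2 ht)]
        simpa only [this, mul_one] using hp x
      · refine ⟨0, fun _ x => ?_⟩
        have : ind ((Submodule.span ℝ {u}).mkQ '' (A i)) ((Submodule.span ℝ {u}).mkQ x0) = 0 := by
          unfold ind; rw [if_neg (fun h => ht ((hmem i).1 h))]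
        simp only [this, mul_zero, ite_self]
        have h0 : ∀ t : ℝ, ind (A i) (x0 + t • u) = 0 := by
          intro t; unfold ind; rw [if_neg (fun h => ht ⟨t, h⟩)]
        simp [h0]
    · exact ⟨0, fun h => absurd h hi⟩
  choose p hp using hp
  have key : ∀ x : ℝ, ∑ i ∈ s, c i * (if x = p i then sgnF (A i) u *
      ind ((Submodule.span ℝ {u}).mkQ '' (A i)) ((Submodule.span ℝ {u}).mkQ x0) else 0) = 0 := by
    intro x
    have hall : ∀ᶠ x' in 𝓝[>] x, ∀ i ∈ s, ind (A i) (x0 + x • u) - ind (A i) (x0 + x' • u) =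
      if x = p i then sgnF (A i) u * ind ((Submodule.span ℝ {u}).mkQ '' (A i))
        ((Submodule.span ℝ {u}).mkQ x0) else 0 := by
      rw [Filter.eventually_all_finset]
      intro i hi
      exact hp i hi x
    obtain ⟨x', h1, h2⟩ := (hall.and (h x0 x)).exists
    have h3 : ∑ i ∈ s, c i * (ind (A i) (x0 + x • u) - ind (A i) (x0 + x' • u)) = 0 := by
      simp only [mul_sub, Finset.sum_sub_distrib]
      rw [h2, sub_self]
    refine Eq.trans ?_ h3
    exact Finset.sum_congr rfl (fun i hi => by rw [h1 i hi])
  have h2 : ∑ x ∈ s.image p, ∑ i ∈ s, c i * (if x = p i then sgnF (A i) u *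
      ind ((Submodule.span ℝ {u}).mkQ '' (A i)) ((Submodule.span ℝ {u}).mkQ x0) else 0) = 0 :=
    Finset.sum_eq_zero fun x _ => key x
  rw [Finset.sum_comm] at h2
  rw [← h2]
  refine Finset.sum_congr rfl fun i hi => ?_
  rw [← Finset.mul_sum, Finset.sum_ite_eq' , if_pos (Finset.mem_image_of_mem p hi), mul_assoc]

lemma finrank_quot [FiniteDimensional ℝ E] (W : Submodule ℝ E) {u : E} (hu : u ≠ 0) :
    Module.finrank ℝ (W.map (Submodule.span ℝ {u}).mkQ) + (if u ∈ W then 1 else 0) =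
      Module.finrank ℝ W := by
  have h1 := LinearMap.finrank_range_add_finrank_ker ((Submodule.span ℝ {u}).mkQ.domRestrict W)
  rw [LinearMap.range_domRestrict] at h1
  rw [← h1]
  congr 1
  have hker : ∀ w : W, w ∈ LinearMap.ker ((Submodule.span ℝ {u}).mkQ.domRestrict W) ↔
      ∃ t : ℝ, t • u = w := by
    intro w
    rw [LinearMap.mem_ker, LinearMap.domRestrict_apply, ← LinearMap.mem_ker, Submodule.ker_mkQ,
      Submodule.mem_span_singleton]
  split_ifs with h
  · have : LinearMap.ker ((Submodule.span ℝ {u}).mkQ.domRestrict W) =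
        Submodule.span ℝ {(⟨u, h⟩ : W)} := by
      ext w
      rw [hker, Submodule.mem_span_singleton]
      simp [Subtype.ext_iff]
    rw [this, finrank_span_singleton]
    intro h0
    exact hu (Subtype.ext_iff.1 h0)
  · have : LinearMap.ker ((Submodule.span ℝ {u}).mkQ.domRestrict W) = ⊥ := by
      rw [Submodule.eq_bot_iff]
      intro w hw
      obtain ⟨t, ht⟩ := (hker w).1 hw
      by_cases ht0 : t = 0
      · rw [ht0, zero_smul] at ht
        exact Subtype.ext ht.symm
      · exact absurd ((Submodule.smul_mem_iff _ ht0).1 (ht ▸ w.2)) h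
    rw [this, finrank_bot]

lemma sign_quot [FiniteDimensional ℝ E] (A : Set E) {u : E} (hu : u ≠ 0) :
    (-1 : ℝ) ^ Module.finrank ℝ (vectorSpan ℝ A) = sgnF A u *
      (-1) ^ Module.finrank ℝ (vectorSpan ℝ ((Submodule.span ℝ {u}).mkQ '' A)) := by
  rw [vectorSpan_image_linear, ← finrank_quot (vectorSpan ℝ A) hu]
  unfold sgnF
  split_ifs
  · rw [pow_succ]; ring
  · simp

lemma euler_zero (n : ℕ) : ∀ {E : Type*} [AddCommGroup E] [Module ℝ E] [FiniteDimensional ℝ E]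
    (_ : Module.finrank ℝ E = n) {ι : Type*} (s : Finset ι) (A : ι → Set E)
    (_ : ∀ i ∈ s, ROC (A i)) (c : ι → ℝ) (_ : ∀ x, ∑ i ∈ s, c i * ind (A i) x = 0),
    ∑ i ∈ s, c i * (-1) ^ Module.finrank ℝ (vectorSpan ℝ (A i)) = 0 := by
  induction n with
  | zero =>
    intro E _ _ _ hn ι s A hA c h
    have hsub : Subsingleton E := Module.finrank_zero_iff.1 hn
    rw [← h 0]
    refine Finset.sum_congr rfl fun i hi => ?_
    congr 1
    have h1 : Module.finrank ℝ (vectorSpan ℝ (A i)) = 0 := Module.finrank_zero_of_subsingleton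
    obtain ⟨a, ha⟩ := (hA i hi).ne
    rw [h1, ind, if_pos (Subsingleton.elim a 0 ▸ ha), pow_zero]
  | succ n ih =>
    intro E _ _ _ hn ι s A hA c h
    have : Nontrivial E := Module.nontrivial_of_finrank_pos (R := ℝ) (by omega)
    obtain ⟨u, hu⟩ := exists_ne (0 : E)
    have h1 := euler_step s A hA c hu (by simp [h])
    have h2 := ih (E := E ⧸ Submodule.span ℝ {u}) (by
      have := Submodule.finrank_quotient_add_finrank (Submodule.span ℝ {u})
      rw [finrank_span_singleton hu] at this
      omega) s (fun i => (Submodule.span ℝ {u}).mkQ '' (A i)) (fun i hi => (hA i hi).image _) _ h1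
    rw [← h2]
    refine Finset.sum_congr rfl fun i hi => ?_
    rw [sign_quot (A i) hu, mul_assoc]

lemma euler_main [FiniteDimensional ℝ E] {ι : Type*} (s : Finset ι) (A : ι → Set E)
    (hA : ∀ i ∈ s, ROC (A i)) {u : E} (hu : u ≠ 0)
    (h : ∀ x0 : E, ∀ x : ℝ, ∀ᶠ x' in 𝓝[>] x,
      ∑ i ∈ s, ind (A i) (x0 + x' • u) = ∑ i ∈ s, ind (A i) (x0 + x • u)) :
    ∑ i ∈ s, (-1 : ℝ) ^ Module.finrank ℝ (vectorSpan ℝ (A i)) = 0 := by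
  have h1 := euler_step s A hA (fun _ => 1) hu (by simpa using h)
  have h2 := euler_zero _ rfl s _ (fun i hi => (hA i hi).image _) _ h1
  rw [← h2]
  refine Finset.sum_congr rfl fun i hi => ?_
  rw [sign_quot (A i) hu, one_mul]

end Euler

end GramAngles

namespace GramAngles

section Faces
open Classical Filter Topology

variable {d n : ℕ}

/-- Indices of the inequalities that are active on all of `F`. -/
def actF (a : Fin n → Module.Dual ℝ (Euc d)) (b : Fin n → ℝ) (F : Set (Euc d)) : Finset (Fin n) :=
  Finset.univ.filter (fun i => ∀ x ∈ F, a i x = b i)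

/-- The points whose active set is exactly `S`. -/
def stratum (a : Fin n → Module.Dual ℝ (Euc d)) (b : Fin n → ℝ) (S : Finset (Fin n)) :
    Set (Euc d) :=
  {x | ∀ i, (i ∈ S → a i x = b i) ∧ (i ∉ S → a i x < b i)}

lemma relPt_extend {F : Set (Euc d)} (hc : Convex ℝ F) (hne : F.Nonempty) :
    relPt F ∈ F ∧ ∀ y ∈ F, ∃ ε : ℝ, 0 < ε ∧ relPt F + ε • (relPt F - y) ∈ F := by
  have hI : (intrinsicInterior ℝ F).Nonempty := hne.intrinsicInterior hc
  have hq : relPt F ∈ intrinsicInterior ℝ F := by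
    unfold relPt
    rw [dif_pos hI]
    exact hI.some_mem
  refine ⟨intrinsicInterior_subset hq, fun y hy => ?_⟩
  obtain ⟨q, hq1, hq2⟩ := mem_intrinsicInterior.1 hq
  have hyA : y ∈ affineSpan ℝ F := subset_affineSpan ℝ F hy
  let g : ℝ → affineSpan ℝ F := fun t => ⟨AffineMap.lineMap (q : Euc d) y (-t),
    AffineMap.lineMap_mem (-t) q.2 hyA⟩
  have hg : Continuous g := by
    refine Continuous.subtype_mk ?_ _
    simp only [AffineMap.lineMap_apply, vsub_eq_sub, vadd_eq_add]
    fun_prop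
  have hg0 : g 0 = q := by
    apply Subtype.ext
    simp [g]
  have h1 : ∀ᶠ t in 𝓝 (0 : ℝ), g t ∈ interior ((↑) ⁻¹' F : Set (affineSpan ℝ F)) := by
    apply hg.continuousAt.eventually_mem
    rw [hg0]
    exact isOpen_interior.mem_nhds hq1
  have h2 : ∀ᶠ t in 𝓝[>] (0 : ℝ), g t ∈ interior ((↑) ⁻¹' F : Set (affineSpan ℝ F)) :=
    h1.filter_mono nhdsWithin_le_nhds
  have h3 : ∀ᶠ t in 𝓝[>] (0 : ℝ), 0 < t := eventually_mem_nhdsWithin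
  obtain ⟨t, ht, ht0⟩ := (h2.and h3).exists
  refine ⟨t, ht0, ?_⟩
  have h4 : (g t : Euc d) ∈ F :=
    (interior_subset ht : g t ∈ ((↑) ⁻¹' F : Set (affineSpan ℝ F)))
  convert h4 using 1
  simp only [g, AffineMap.lineMap_apply, vsub_eq_sub, vadd_eq_add, hq2]
  module

/-- Finitely many strict inequalities survive a small perturbation. -/
lemma exists_eps (a : Fin n → Module.Dual ℝ (Euc d)) (b : Fin n → ℝ) (q v : Euc d) :
    ∃ ε : ℝ, 0 < ε ∧ ∀ i, a i q < b i → a i (q + ε • v) < b i := by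
  have h2 : ∀ᶠ t in 𝓝[>] (0 : ℝ), ∀ i, a i q < b i → a i (q + t • v) < b i := by
    rw [Filter.eventually_all]
    intro i
    by_cases h : a i q < b i
    · have : Tendsto (fun t : ℝ => a i q + t * a i v) (𝓝 0) (𝓝 (a i q + 0 * a i v)) :=
        (Continuous.tendsto (by fun_prop) 0)
      rw [zero_mul, add_zero] at this
      filter_upwards [(this.eventually (gt_mem_nhds h)).filter_mono nhdsWithin_le_nhds] with t ht _
      simpa using ht
    · simp [h]
  have h3 : ∀ᶠ t in 𝓝[>] (0 : ℝ), 0 < t := eventually_mem_nhdsWithin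
  obtain ⟨t, ht, ht0⟩ := (h2.and h3).exists
  exact ⟨t, ht0, ht⟩

variable {a : Fin n → Module.Dual ℝ (Euc d)} {b : Fin n → ℝ} {P : Set (Euc d)}

lemma convex_of_hrep (hP : P = {x | ∀ i, a i x ≤ b i}) : Convex ℝ P := by
  rw [hP]
  intro x hx y hy s t hs ht hst i
  have h1 := mul_le_mul_of_nonneg_left (hx i) hs
  have h2 := mul_le_mul_of_nonneg_left (hy i) ht
  have h3 : s * b i + t * b i = b i := by rw [← add_mul, hst, one_mul]
  simp only [map_add, map_smul, smul_eq_mul]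
  linarith

lemma relPt_mem_stratum (hP : P = {x | ∀ i, a i x ≤ b i}) {F : Set (Euc d)} (hF : IsFace P F)
    (hne : F.Nonempty) : relPt F ∈ stratum a b (actF a b F) := by
  have hFP : F ⊆ P := IsExposed.subset hF
  have hFc : Convex ℝ F := IsExposed.convex hF (convex_of_hrep hP)
  obtain ⟨hq, hq2⟩ := relPt_extend hFc hne
  intro i
  refine ⟨fun hi => (Finset.mem_filter.1 hi).2 _ hq, fun hi => ?_⟩
  have hle : ∀ x ∈ F, a i x ≤ b i := fun x hx => by
    have := hFP hx
    rw [hP] at this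
    exact this i
  refine lt_of_le_of_ne (hle _ hq) fun heq => hi (Finset.mem_filter.2 ⟨Finset.mem_univ _, ?_⟩)
  intro y hy
  obtain ⟨ε, he, h⟩ := hq2 y hy
  have h1 := hle _ h
  simp only [map_add, map_smul, map_sub, smul_eq_mul, heq] at h1
  have h2 := hle y hy
  have h3 : ε * (b i - a i y) ≤ 0 := by linarith
  have h4 : b i - a i y ≤ 0 := nonpos_of_mul_nonpos_right h3 he
  linarith

lemma face_eq (hP : P = {x | ∀ i, a i x ≤ b i}) {F : Set (Euc d)} (hF : IsFace P F)
    (hne : F.Nonempty) : F = {x | x ∈ P ∧ ∀ i ∈ actF a b F, a i x = b i} := by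
  have hFP : F ⊆ P := IsExposed.subset hF
  have hFc : Convex ℝ F := IsExposed.convex hF (convex_of_hrep hP)
  obtain ⟨hq, -⟩ := relPt_extend hFc hne
  have hqS := relPt_mem_stratum hP hF hne
  set q := relPt F
  ext x
  constructor
  · intro hx
    exact ⟨hFP hx, fun i hi => (Finset.mem_filter.1 hi).2 _ hx⟩
  · rintro ⟨hx, hxa⟩
    obtain ⟨l, hl⟩ := hF hne
    rw [hl] at hq ⊢
    obtain ⟨ε, he, h⟩ := exists_eps a b q (q - x)
    have h1 : q + ε • (q - x) ∈ P := by
      rw [hP]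
      intro i
      by_cases hi : i ∈ actF a b F
      · have e1 := (hqS i).1 hi
        have e2 := hxa i hi
        simp [e1, e2]
      · exact (h i ((hqS i).2 hi)).le
    have h2 := hq.2 _ h1
    simp only [map_add, map_smul, map_sub, smul_eq_mul] at h2
    have h3 : ε * (l q - l x) ≤ 0 := by linarith
    have h4 : l q - l x ≤ 0 := nonpos_of_mul_nonpos_right h3 he
    exact ⟨hx, fun y hy => by linarith [hq.2 y hy]⟩

lemma stratum_roc (hP : P = {x | ∀ i, a i x ≤ b i}) (hcp : IsCompact P) {S : Finset (Fin n)}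
    (hne : (stratum a b S).Nonempty) : ROC (stratum a b S) where
  ne := hne
  conv := by
    intro x hx y hy s t hs ht hst i
    have h3 : s * b i + t * b i = b i := by rw [← add_mul, hst, one_mul]
    simp only [map_add, map_smul, smul_eq_mul]
    refine ⟨fun hi => ?_, fun hi => ?_⟩
    · rw [(hx i).1 hi, (hy i).1 hi, h3]
    · have h1 := (hx i).2 hi
      have h2 := (hy i).2 hi
      rcases hs.eq_or_lt with h0 | h0
      · subst h0
        have : t = 1 := by linarith
        subst this
        simpa using h2
      · have h4 := mul_lt_mul_of_pos_left h1 h0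
        have h5 := mul_le_mul_of_nonneg_left h2.le ht
        linarith
  ro := by
    intro x hx v hv
    obtain ⟨ε, he, h⟩ := exists_eps a b x v
    refine ⟨ε, he, fun i => ⟨fun hi => ?_, fun hi => h i ((hx i).2 hi)⟩⟩
    have hv0 : a i v = 0 := by
      have : vectorSpan ℝ (stratum a b S) ≤ LinearMap.ker (a i) := by
        unfold vectorSpan
        rw [Submodule.span_le]
        rintro _ ⟨y, hy, z, hz, rfl⟩
        simp [(hy i).1 hi, (hz i).1 hi]
      exact this hv
    simp [hv0, (hx i).1 hi]
  bd := by
    intro l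
    have hl : Continuous l := LinearMap.continuous_of_finiteDimensional l
    obtain ⟨M, hM⟩ := (hcp.image hl).bddAbove
    refine ⟨M, fun x hx => hM ⟨x, ?_, rfl⟩⟩
    rw [hP]
    intro i
    by_cases hi : i ∈ S
    · exact ((hx i).1 hi).le
    · exact ((hx i).2 hi).le

lemma vectorSpan_stratum (hP : P = {x | ∀ i, a i x ≤ b i}) {F : Set (Euc d)} (hF : IsFace P F)
    (hne : F.Nonempty) : vectorSpan ℝ (stratum a b (actF a b F)) = vectorSpan ℝ F := by
  have hqS := relPt_mem_stratum hP hF hne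
  set q := relPt F
  apply le_antisymm
  · apply vectorSpan_mono
    intro x hx
    rw [face_eq hP hF hne, hP]
    refine ⟨fun i => ?_, fun i hi => (hx i).1 hi⟩
    by_cases hi : i ∈ actF a b F
    · exact ((hx i).1 hi).le
    · exact ((hx i).2 hi).le
  · have key : ∀ y ∈ F, y - q ∈ vectorSpan ℝ (stratum a b (actF a b F)) := by
      intro y hy
      rw [face_eq hP hF hne, hP] at hy
      have hm : (1 / 2 : ℝ) • q + (1 / 2 : ℝ) • y ∈ stratum a b (actF a b F) := by
        intro i
        simp only [map_add, map_smul, smul_eq_mul]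
        refine ⟨fun hi => ?_, fun hi => ?_⟩
        · rw [(hqS i).1 hi, hy.2 i hi]; ring
        · linarith [(hqS i).2 hi, hy.1 i]
      have := vsub_mem_vectorSpan ℝ hm hqS
      have h2 := Submodule.smul_mem _ (2 : ℝ) this
      convert h2 using 1
      simp only [vsub_eq_sub]
      module
    rw [vectorSpan_def ℝ F, Submodule.span_le]
    rintro _ ⟨y, hy, z, hz, rfl⟩
    have := Submodule.sub_mem _ (key y hy) (key z hz)
    simpa using this

lemma innerCone_eq (hP : P = {x | ∀ i, a i x ≤ b i}) (hdim : sdim P = d) {F : Set (Euc d)}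
    (hF : IsFace P F) (hne : F.Nonempty) :
    innerCone F P = {u | ∀ i ∈ actF a b F, a i u ≤ 0} := by
  have hqS := relPt_mem_stratum hP hF hne
  have htop : vectorSpan ℝ P = ⊤ := by
    apply Submodule.eq_top_of_finrank_eq
    rw [show Module.finrank ℝ (vectorSpan ℝ P) = d from hdim]
    simp
  unfold innerCone
  rw [htop, Submodule.top_orthogonal_eq_bot]
  set q := relPt F
  ext u
  simp only [Submodule.bot_coe, Set.add_singleton, Set.image_id', add_zero]
  constructor
  · rintro ⟨c, _, ⟨x, hx, rfl⟩, hc, rfl⟩ i hi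
    rw [hP] at hx
    simp only [map_smul, map_sub, smul_eq_mul, (hqS i).1 hi]
    exact mul_nonpos_of_nonneg_of_nonpos hc (by linarith [hx i])
  · intro hu
    obtain ⟨ε, he, h⟩ := exists_eps a b q u
    refine ⟨ε⁻¹, ε • u, ⟨q + ε • u, ?_, by simp⟩, by positivity, ?_⟩
    · rw [hP]
      intro i
      by_cases hi : i ∈ actF a b F
      · have h1 := mul_nonpos_of_nonneg_of_nonpos he.le (hu i hi)
        simp only [map_smul, map_add, smul_eq_mul, (hqS i).1 hi]
        linarith
      · exact (h i ((hqS i).2 hi)).le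
    · rw [smul_smul, inv_mul_cancel₀ he.ne', one_smul]

/-- The active set of a point. -/
def actP (a : Fin n → Module.Dual ℝ (Euc d)) (b : Fin n → ℝ) (x : Euc d) : Finset (Fin n) :=
  Finset.univ.filter (fun i => a i x = b i)

lemma face_of_point (hP : P = {x | ∀ i, a i x ≤ b i}) {x : Euc d} (hx : x ∈ P) :
    ∃ F, IsFace P F ∧ F.Nonempty ∧ actF a b F = actP a b x := by
  refine ⟨{y | y ∈ P ∧ ∀ i ∈ actP a b x, a i y = b i}, ?_, ⟨x, hx, ?_⟩, ?_⟩
  · intro _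
    refine ⟨∑ i ∈ actP a b x, LinearMap.toContinuousLinearMap (a i), ?_⟩
    have hsum : ∀ y, (∑ i ∈ actP a b x, LinearMap.toContinuousLinearMap (a i)) y =
        ∑ i ∈ actP a b x, a i y := by
      intro y
      rw [sum_apply]
      rfl
    have hle : ∀ y ∈ P, ∀ i ∈ actP a b x, a i y ≤ b i := by
      intro y hy i _
      rw [hP] at hy
      exact hy i
    ext y
    simp only [Set.mem_ofPred_eq, hsum]
    refine and_congr_right fun hy => ⟨fun h z hz => ?_, fun h i hi => ?_⟩
    · rw [Finset.sum_congr rfl h]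
      exact Finset.sum_le_sum (hle z hz)
    · have h1 := h x hx
      have h2 : ∑ i ∈ actP a b x, a i x = ∑ i ∈ actP a b x, b i :=
        Finset.sum_congr rfl fun i hi => (Finset.mem_filter.1 hi).2
      rw [h2] at h1
      exact (Finset.sum_eq_sum_iff_of_le (hle y hy)).1
        (le_antisymm (Finset.sum_le_sum (hle y hy)) h1) i hi
  · intro i hi
    exact (Finset.mem_filter.1 hi).2
  · ext i
    constructor
    · intro hi
      refine Finset.mem_filter.2 ⟨Finset.mem_univ _, (Finset.mem_filter.1 hi).2 x ⟨hx, ?_⟩⟩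
      intro j hj
      exact (Finset.mem_filter.1 hj).2
    · intro hi
      refine Finset.mem_filter.2 ⟨Finset.mem_univ _, fun y hy => hy.2 i hi⟩

lemma face_ext (hP : P = {x | ∀ i, a i x ≤ b i}) {F G : Set (Euc d)} (hF : IsFace P F)
    (hne : F.Nonempty) (hG : IsFace P G) (hGne : G.Nonempty) (h : actF a b F = actF a b G) :
    F = G := by
  rw [face_eq hP hF hne, face_eq hP hG hGne, h]

lemma faces_finite (hP : P = {x | ∀ i, a i x ≤ b i}) :
    {F : Set (Euc d) | IsFace P F ∧ F.Nonempty}.Finite := by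
  refine Set.Finite.of_finite_image (f := actF a b) (Set.toFinite _) ?_
  intro F hF G hG h
  exact face_ext hP hF.1 hF.2 hG.1 hG.2 h

lemma euler_faces (hP : P = {x | ∀ i, a i x ≤ b i}) (hcp : IsCompact P)
    (Φ : Finset (Set (Euc d))) (hΦ : ∀ F, F ∈ Φ ↔ IsFace P F ∧ F.Nonempty)
    {u : Euc d} (hu0 : u ≠ 0) (hu : ∀ i, a i u ≠ 0) :
    ∑ F ∈ Φ with (∀ i ∈ actF a b F, a i u < 0), (-1 : ℝ) ^ sdim F = 0 := by
  have hst : ∀ x S, x ∈ stratum a b S → S = actP a b x := by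
    intro x S hx
    ext i
    constructor
    · intro hi
      exact Finset.mem_filter.2 ⟨Finset.mem_univ _, (hx i).1 hi⟩
    · intro hi
      by_contra hi'
      exact ((hx i).2 hi').ne (Finset.mem_filter.1 hi).2
  have hsum : ∀ x, ∑ F ∈ Φ with (∀ i ∈ actF a b F, a i u < 0), ind (stratum a b (actF a b F)) x =
      if (∀ i, a i x ≤ b i ∧ (0 < a i u → a i x < b i)) then 1 else 0 := by
    intro x
    split_ifs with h
    · have hx : x ∈ P := by rw [hP]; exact fun i => (h i).1
      obtain ⟨F, hF, hFne, hact⟩ := face_of_point hP hx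
      rw [Finset.sum_eq_single F]
      · have : x ∈ stratum a b (actF a b F) := by
          rw [hact]
          intro i
          refine ⟨fun hi => (Finset.mem_filter.1 hi).2, fun hi => lt_of_le_of_ne (h i).1 ?_⟩
          intro h'
          exact hi (Finset.mem_filter.2 ⟨Finset.mem_univ _, h'⟩)
        rw [ind, if_pos this]
      · intro G hG hGF
        rw [ind, if_neg]
        intro hxG
        have hG' := (hΦ G).1 (Finset.mem_filter.1 hG).1
        exact hGF (face_ext hP hG'.1 hG'.2 hF hFne (by rw [hact, hst x _ hxG]))
      · intro hF'
        refine absurd (Finset.mem_filter.2 ⟨(hΦ F).2 ⟨hF, hFne⟩, fun i hi => ?_⟩) hF'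
        rw [hact] at hi
        have h1 := (Finset.mem_filter.1 hi).2
        refine lt_of_le_of_ne (not_lt.1 fun h2 => ?_) (hu i)
        exact ((h i).2 h2).ne h1
    · refine Finset.sum_eq_zero fun F hF => ?_
      rw [ind, if_neg]
      intro hx
      apply h
      intro i
      by_cases hi : i ∈ actF a b F
      · refine ⟨((hx i).1 hi).le, fun h2 => ?_⟩
        have := (Finset.mem_filter.1 hF).2 i hi
        linarith
      · exact ⟨((hx i).2 hi).le, fun _ => (hx i).2 hi⟩
  have key := euler_main (E := Euc d) (Φ.filter (fun F => ∀ i ∈ actF a b F, a i u < 0))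
    (fun F => stratum a b (actF a b F))
    (fun F hF => by
      have hF' := (hΦ F).1 (Finset.mem_filter.1 hF).1
      exact stratum_roc hP hcp ⟨_, relPt_mem_stratum hP hF'.1 hF'.2⟩) hu0
    (by
      intro x0 x
      simp only [hsum]
      have hgt : ∀ᶠ x' in 𝓝[>] x, x < x' := eventually_mem_nhdsWithin
      have hall : ∀ᶠ x' in 𝓝[>] x, ∀ i,
          ((a i (x0 + x' • u) ≤ b i ∧ (0 < a i u → a i (x0 + x' • u) < b i)) ↔
          (a i (x0 + x • u) ≤ b i ∧ (0 < a i u → a i (x0 + x • u) < b i))) := by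
        rw [Filter.eventually_all]
        intro i
        simp only [map_add, map_smul, smul_eq_mul]
        have hcont : Tendsto (fun t : ℝ => a i x0 + t * a i u) (𝓝[>] x) (𝓝 (a i x0 + x * a i u)) :=
          (Continuous.tendsto (by fun_prop) x).mono_left nhdsWithin_le_nhds
        rcases lt_or_gt_of_ne (hu i) with h | h
        · simp only [not_lt.2 h.le, false_imp_iff, and_true]
          rcases le_or_gt (a i x0 + x * a i u) (b i) with h1 | h1
          · filter_upwards [hgt] with t ht
            have := mul_le_mul_of_nonpos_right ht.le h.le
            exact ⟨fun _ => h1, fun _ => by linarith⟩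
          · filter_upwards [hcont.eventually (lt_mem_nhds h1)] with t ht
            exact ⟨fun h => absurd h (not_le.2 ht), fun h => absurd h (not_le.2 h1)⟩
        · simp only [h, true_imp_iff]
          rcases lt_or_ge (a i x0 + x * a i u) (b i) with h1 | h1
          · filter_upwards [hcont.eventually (gt_mem_nhds h1)] with t ht
            exact ⟨fun _ => ⟨h1.le, h1⟩, fun _ => ⟨ht.le, ht⟩⟩
          · filter_upwards [hgt] with t ht
            have := mul_le_mul_of_nonneg_right ht.le h.le
            exact ⟨fun h => absurd h.2 (not_lt.2 (by linarith)), fun h => absurd h.2 (not_lt.2 h1)⟩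
      filter_upwards [hall] with x' hx'
      exact if_congr (forall_congr' hx') rfl rfl)
  refine Eq.trans ?_ key
  refine Finset.sum_congr rfl fun F hF => ?_
  have hF' := (hΦ F).1 (Finset.mem_filter.1 hF).1
  rw [vectorSpan_stratum hP hF'.1 hF'.2, sdim]

end Faces

end GramAngles

namespace GramAngles

section Cutting
open Classical

variable {d n : ℕ}

/-- Cones given by finitely many linear inequalities. -/
def IsHCone (C : Set (Euc d)) : Prop :=
  ∃ T : Finset (Module.Dual ℝ (Euc d)), C = {x | ∀ f ∈ T, f x ≤ 0}

lemma IsHCone.isPolyhedralCone {C : Set (Euc d)} (h : IsHCone C) : IsPolyhedralCone C := by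
  obtain ⟨T, rfl⟩ := h
  exact isPolyhedralCone_hcone T id

lemma isHCone_univ : IsHCone (Set.univ : Set (Euc d)) := ⟨∅, by ext; simp⟩

lemma IsHCone.inter_le {C : Set (Euc d)} (h : IsHCone C) (g : Module.Dual ℝ (Euc d)) :
    IsHCone (C ∩ {x | g x ≤ 0}) := by
  obtain ⟨T, rfl⟩ := h
  refine ⟨insert g T, ?_⟩
  ext x
  simp [and_comm]

lemma IsHCone.inter_ge {C : Set (Euc d)} (h : IsHCone C) (g : Module.Dual ℝ (Euc d)) :
    IsHCone (C ∩ {x | 0 ≤ g x}) := by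
  have := h.inter_le (-g)
  simpa using this

lemma sdim_lt {X : Set (Euc d)} {g : Module.Dual ℝ (Euc d)} (hg : g ≠ 0) (β : ℝ)
    (hX : ∀ x ∈ X, g x = β) : sdim X < d := by
  have h1 : vectorSpan ℝ X ≤ LinearMap.ker g := by
    unfold vectorSpan
    rw [Submodule.span_le]
    rintro _ ⟨y, hy, z, hz, rfl⟩
    simp [hX y hy, hX z hz]
  have h2 : LinearMap.ker g ≠ ⊤ := fun h => hg (LinearMap.ker_eq_top.1 h)
  have h3 := Submodule.finrank_lt h2
  have h4 := Submodule.finrank_mono h1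
  simp only [finrank_euclideanSpace, Fintype.card_fin] at h3
  unfold sdim
  omega

lemma cut (α : ConeAngle d) {C : Set (Euc d)} (hC : IsHCone C) {g : Module.Dual ℝ (Euc d)}
    (hg : g ≠ 0) :
    α.toFun C = α.toFun (C ∩ {x | g x ≤ 0}) + α.toFun (C ∩ {x | 0 ≤ g x}) := by
  have hun : (C ∩ {x | g x ≤ 0}) ∪ (C ∩ {x | 0 ≤ g x}) = C := by
    ext x
    have := le_total (g x) 0
    simp only [Set.mem_union, Set.mem_inter_iff, Set.mem_ofPred_eq]
    tauto
  have hcap : (C ∩ {x | g x ≤ 0}) ∩ (C ∩ {x | 0 ≤ g x}) =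
      (C ∩ {x | g x ≤ 0}) ∩ {x | 0 ≤ g x} := by
    ext x
    simp only [Set.mem_inter_iff, Set.mem_ofPred_eq]
    tauto
  have hpi : IsPolyhedralCone ((C ∩ {x | g x ≤ 0}) ∩ (C ∩ {x | 0 ≤ g x})) := by
    rw [hcap]
    exact ((hC.inter_le g).inter_ge g).isPolyhedralCone
  have h := α.union' _ _ (hC.inter_le g).isPolyhedralCone (hC.inter_ge g).isPolyhedralCone
    (by rw [hun]; exact hC.isPolyhedralCone) hpi
  have h0 := α.simple' _ hpi (sdim_lt hg 0 (fun x hx => le_antisymm hx.1.2 hx.2.2))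
  rw [hun, h0, sub_zero] at h
  exact h

/-- Closed cells of the arrangement `a i = 0`, `i ∈ K`. -/
def cell (a : Fin n → Module.Dual ℝ (Euc d)) (K σ : Finset (Fin n)) : Set (Euc d) :=
  {u | ∀ i ∈ K, (i ∈ σ → 0 ≤ a i u) ∧ (i ∉ σ → a i u ≤ 0)}

lemma cell_insert_neg (a : Fin n → Module.Dual ℝ (Euc d)) {K σ : Finset (Fin n)} {i : Fin n}
    (hi : i ∉ σ) : cell a (insert i K) σ = cell a K σ ∩ {x | a i x ≤ 0} := by
  ext u
  simp only [cell, Finset.forall_mem_insert, Set.mem_inter_iff, Set.mem_ofPred_eq]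
  tauto

lemma cell_insert_pos (a : Fin n → Module.Dual ℝ (Euc d)) {K σ : Finset (Fin n)} {i : Fin n}
    (hiK : i ∉ K) : cell a (insert i K) (insert i σ) = cell a K σ ∩ {x | 0 ≤ a i x} := by
  ext u
  simp only [cell, Finset.forall_mem_insert, Set.mem_inter_iff, Set.mem_ofPred_eq]
  simp only [Finset.mem_insert, true_or, not_true, false_imp_iff, and_true, true_imp_iff]
  rw [and_comm]
  refine and_congr_left fun _ => forall₂_congr fun j hj => ?_
  have : j ≠ i := fun h => hiK (h ▸ hj)
  simp [this]

lemma isHCone_inter_cell (a : Fin n → Module.Dual ℝ (Euc d)) {C : Set (Euc d)} (hC : IsHCone C)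
    (K σ : Finset (Fin n)) : IsHCone (C ∩ cell a K σ) := by
  induction K using Finset.induction_on with
  | empty => simpa [cell] using hC
  | insert i K hi ih =>
    by_cases h : i ∈ σ
    · have : C ∩ cell a (insert i K) σ = (C ∩ cell a K σ) ∩ {x | 0 ≤ a i x} := by
        ext u
        simp only [cell, Finset.forall_mem_insert, Set.mem_inter_iff, Set.mem_ofPred_eq]
        tauto
      rw [this]; exact ih.inter_ge _
    · rw [cell_insert_neg a h, ← Set.inter_assoc]
      exact ih.inter_le _

lemma cut_cells (α : ConeAngle d) (a : Fin n → Module.Dual ℝ (Euc d)) (ha : ∀ i, a i ≠ 0)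
    {C : Set (Euc d)} (hC : IsHCone C) (K : Finset (Fin n)) :
    α.toFun C = ∑ σ ∈ K.powerset, α.toFun (C ∩ cell a K σ) := by
  induction K using Finset.induction_on with
  | empty => simp [cell]
  | insert i K hi ih =>
    rw [Finset.sum_powerset_insert hi, ih, ← Finset.sum_add_distrib]
    refine Finset.sum_congr rfl fun σ hσ => ?_
    have hiσ : i ∉ σ := fun h => hi (Finset.mem_powerset.1 hσ h)
    rw [cell_insert_neg a hiσ, cell_insert_pos a hi, ← Set.inter_assoc, ← Set.inter_assoc]
    exact cut α (isHCone_inter_cell a hC K σ) (ha i)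

lemma isHCone_of_index (a : Fin n → Module.Dual ℝ (Euc d)) (J : Finset (Fin n)) :
    IsHCone {u | ∀ i ∈ J, a i u ≤ 0} := ⟨J.image a, by ext; simp⟩

lemma angle_cells (α : ConeAngle d) (a : Fin n → Module.Dual ℝ (Euc d)) (ha : ∀ i, a i ≠ 0)
    (J : Finset (Fin n)) :
    α.toFun {u | ∀ i ∈ J, a i u ≤ 0} =
      ∑ σ : Finset (Fin n), if Disjoint J σ then α.toFun (cell a Finset.univ σ) else 0 := by
  rw [cut_cells α a ha (isHCone_of_index a J) Finset.univ, Finset.powerset_univ]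
  refine Finset.sum_congr rfl fun σ _ => ?_
  split_ifs with h
  · congr 1
    rw [Set.inter_eq_right]
    intro u hu i hi
    exact (hu i (Finset.mem_univ _)).2 (Finset.disjoint_left.1 h hi)
  · rw [Finset.not_disjoint_iff] at h
    obtain ⟨i, hiJ, hiσ⟩ := h
    refine α.simple' _ (isHCone_inter_cell a (isHCone_of_index a J) _ _).isPolyhedralCone
      (sdim_lt (ha i) 0 fun x hx => ?_)
    exact le_antisymm (hx.1 i hiJ) ((hx.2 i (Finset.mem_univ _)).1 hiσ)

lemma cell_generic (α : ConeAngle d) (a : Fin n → Module.Dual ℝ (Euc d)) (ha : ∀ i, a i ≠ 0)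
    (σ : Finset (Fin n)) (h : α.toFun (cell a Finset.univ σ) ≠ 0) :
    ∃ u ∈ cell a Finset.univ σ, ∀ i, a i u ≠ 0 := by
  have h1 : ∀ i, ∃ u ∈ cell a Finset.univ σ, a i u ≠ 0 := by
    intro i
    by_contra hcon
    push Not at hcon
    apply h
    have hp := (isHCone_inter_cell a isHCone_univ Finset.univ σ).isPolyhedralCone
    rw [Set.univ_inter] at hp
    exact α.simple' _ hp (sdim_lt (ha i) 0 hcon)
  choose u hu hne using h1
  refine ⟨∑ j, u j, ?_, ?_⟩
  · intro i _
    rw [map_sum]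
    exact ⟨fun hi => Finset.sum_nonneg fun j _ => (hu j i (Finset.mem_univ _)).1 hi,
      fun hi => Finset.sum_nonpos fun j _ => (hu j i (Finset.mem_univ _)).2 hi⟩
  · intro i h0
    rw [map_sum] at h0
    by_cases hi : i ∈ σ
    · exact hne i ((Finset.sum_eq_zero_iff_of_nonneg
        (fun j _ => (hu j i (Finset.mem_univ _)).1 hi)).1 h0 i (Finset.mem_univ _))
    · exact hne i ((Finset.sum_eq_zero_iff_of_nonpos
        (fun j _ => (hu j i (Finset.mem_univ _)).2 hi)).1 h0 i (Finset.mem_univ _))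

variable {a : Fin n → Module.Dual ℝ (Euc d)} {b : Fin n → ℝ} {P : Set (Euc d)}

lemma gram_full (hd : 0 < d) (α : ConeAngle d) (ha : ∀ i, a i ≠ 0)
    (hP : P = {x | ∀ i, a i x ≤ b i}) (hcp : IsCompact P) (hdim : sdim P = d)
    (Φ : Finset (Set (Euc d))) (hΦ : ∀ F, F ∈ Φ ↔ IsFace P F ∧ F.Nonempty) :
    ∑ F ∈ Φ, (-1 : ℝ) ^ sdim F * intAngle α F P = 0 := by
  have h1 : ∀ F ∈ Φ, (-1 : ℝ) ^ sdim F * intAngle α F P =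
      ∑ σ : Finset (Fin n), α.toFun (cell a Finset.univ σ) *
        (if Disjoint (actF a b F) σ then (-1 : ℝ) ^ sdim F else 0) := by
    intro F hF
    have hF' := (hΦ F).1 hF
    rw [intAngle, innerCone_eq hP hdim hF'.1 hF'.2, angle_cells α a ha, Finset.mul_sum]
    refine Finset.sum_congr rfl fun σ _ => ?_
    split_ifs
    · ring
    · ring
  rw [Finset.sum_congr rfl h1, Finset.sum_comm]
  refine Finset.sum_eq_zero fun σ _ => ?_
  rw [← Finset.mul_sum]
  by_cases h0 : α.toFun (cell a Finset.univ σ) = 0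
  · rw [h0, zero_mul]
  obtain ⟨u, hu, hne⟩ := cell_generic α a ha σ h0
  have hu0 : u ≠ 0 := by
    rintro rfl
    have hn : IsEmpty (Fin n) := ⟨fun i => hne i (map_zero _)⟩
    have hPu : P = Set.univ := by
      rw [hP]; ext x; simp
    have : Nonempty (Fin d) := ⟨⟨0, hd⟩⟩
    have : NoncompactSpace (Euc d) := NormedSpace.noncompactSpace ℝ (Euc d)
    rw [hPu] at hcp
    exact noncompact_univ (Euc d) hcp
  have := euler_faces hP hcp Φ hΦ hu0 hne
  rw [← Finset.sum_filter]
  rw [Finset.filter_congr (q := fun F => ∀ i ∈ actF a b F, a i u < 0), this, mul_zero]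
  intro F _
  rw [Finset.disjoint_left]
  refine forall₂_congr fun i _ => ⟨fun hi => ?_, fun hi hiσ => ?_⟩
  · exact lt_of_le_of_ne ((hu i (Finset.mem_univ _)).2 hi) (hne i)
  · exact absurd ((hu i (Finset.mem_univ _)).1 hiσ) (not_le.2 hi)

end Cutting

open Classical in
/-- Gram's relation.
For a cone angle `α` on `ℝ^d` (`d ≥ 1`) and a full-dimensional polytope `P ⊂ ℝ^d`:
`α̂₀(P) - α̂₁(P) + ⋯ + (-1)^{d-1} α̂_{d-1}(P) = (-1)^{d+1}`. -/
lemma gram_aux (d : ℕ) (hd : 0 < d) (α : ConeAngle d) (P : Set (Euc d))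
    (hP : IsPolytope P) (hdim : sdim P = d) :
    ∑ i ∈ Finset.range d, (-1 : ℝ) ^ i * intAngleSum α P i = (-1) ^ (d + 1) := by
  obtain ⟨n, a, b, ha, hrep⟩ := polytope_hrep hP
  have hPne : P.Nonempty := by
    obtain ⟨s, hs, rfl⟩ := hP
    simpa using hs
  have hcp : IsCompact P := by
    obtain ⟨s, hs, rfl⟩ := hP
    exact s.finite_toSet.isCompact_convexHull ℝ
  set Φ := (faces_finite hrep).toFinset with hΦdef
  have hΦ : ∀ F, F ∈ Φ ↔ IsFace P F ∧ F.Nonempty := by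
    intro F
    rw [hΦdef, Set.Finite.mem_toFinset]
    rfl
  have hfull := gram_full hd α ha hrep hcp hdim Φ hΦ
  have hact : ∀ F, sdim F = d → actF a b F = ∅ := by
    intro F hF
    rw [Finset.eq_empty_iff_forall_notMem]
    intro i hi
    have := sdim_lt (ha i) (b i) (Finset.mem_filter.1 hi).2
    omega
  have hPface : IsFace P P := IsExposed.refl P
  have hPΦ : P ∈ Φ := (hΦ P).2 ⟨hPface, hPne⟩
  have htopF : ∀ F ∈ Φ, sdim F = d → F = P := by
    intro F hF hFd
    have hF' := (hΦ F).1 hF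
    exact face_ext hrep hF'.1 hF'.2 hPface hPne (by rw [hact F hFd, hact P hdim])
  have hPang : intAngle α P P = 1 := by
    rw [intAngle, innerCone_eq hrep hdim hPface hPne, hact P hdim]
    simpa using α.norm'
  have hle : ∀ F : Set (Euc d), sdim F ≤ d := by
    intro F
    have := Submodule.finrank_le (vectorSpan ℝ F)
    simpa [sdim] using this
  have hsum : ∀ i, intAngleSum α P i = ∑ F ∈ Φ, if sdim F = i then intAngle α F P else 0 := by
    intro i
    rw [← Finset.sum_filter, ← finsum_mem_coe_finset, intAngleSum]
    have : {F : Set (Euc d) | IsFace P F ∧ F.Nonempty ∧ sdim F = i} =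
        ((Φ.filter (fun F => sdim F = i) : Finset (Set (Euc d))) : Set (Set (Euc d))) := by
      ext F
      simp only [Set.mem_ofPred_eq, Finset.coe_filter, hΦ]
      tauto
    rw [this]
  have hL : ∑ i ∈ Finset.range d, (-1 : ℝ) ^ i * intAngleSum α P i =
      ∑ F ∈ Φ.erase P, (-1 : ℝ) ^ sdim F * intAngle α F P := by
    simp only [hsum, Finset.mul_sum]
    rw [Finset.sum_comm, ← Finset.sum_erase_add _ _ hPΦ]
    have hz : ∑ i ∈ Finset.range d, (-1 : ℝ) ^ i * (if sdim P = i then intAngle α P P else 0) = 0 := by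
      refine Finset.sum_eq_zero fun i hi => ?_
      have := Finset.mem_range.1 hi
      rw [if_neg (by omega), mul_zero]
    rw [hz, add_zero]
    refine Finset.sum_congr rfl fun F hF => ?_
    have hF' := Finset.mem_erase.1 hF
    have hlt : sdim F < d := lt_of_le_of_ne (hle F) fun h => hF'.1 (htopF F hF'.2 h)
    rw [Finset.sum_eq_single (sdim F)]
    · simp
    · intro i _ hi
      rw [if_neg hi.symm, mul_zero]
    · intro h
      exact absurd (Finset.mem_range.2 hlt) h
  rw [hL]
  rw [← Finset.sum_erase_add _ _ hPΦ, hPang, hdim] at hfull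
  rw [pow_succ]
  linarith

end GramAngles

namespace GramAngles

/-- Gram's relation.
For a cone angle `α` on `ℝ^d` (`d ≥ 1`) and a full-dimensional polytope `P ⊂ ℝ^d`:
`α̂₀(P) - α̂₁(P) + ⋯ + (-1)^{d-1} α̂_{d-1}(P) = (-1)^{d+1}`. -/
theorem statement1 (d : ℕ) (hd : 0 < d) (α : ConeAngle d) (P : Set (Euc d))
    (hP : IsPolytope P) (hdim : sdim P = d) :
    ∑ i ∈ Finset.range d, (-1 : ℝ) ^ i * intAngleSum α P i = (-1) ^ (d + 1) := by
  exact gram_aux d hd α P hP hdim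

end GramAngles
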